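/- Let n ≥ 2 and let Φ ∈ H with Φ ≠ 0. Then ψ⁻_Φ achieves equality in the sharp spinorial Sobolev inequality on ℝⁿ: (∫_{ℝⁿ} ‖Dψ⁻_Φ(x)‖^{2n/(n+1)} dx)^{(n+1)/n} = (n/2) · ωₙ^{1/n} · ∫_{ℝⁿ} ⟨Dψ⁻_Φ(x), ψ⁻_Φ(x)⟩ dx, where both integrals are finite. -/

import Mathlib

open scoped RealInnerProductSpace
open MeasureTheory

noncomputable section

/-- The Dirac operator on spinor fields `ψ : ℝⁿ → H`, relative to Clifford
multiplication `γ` and the standard orthonormal basis of `ℝⁿ`. -/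
def Dirac {n : ℕ} {H : Type*} [NormedAddCommGroup H] [InnerProductSpace ℝ H]
    (γ : EuclideanSpace ℝ (Fin n) →ₗ[ℝ] H →ₗ[ℝ] H)
    (ψ : EuclideanSpace ℝ (Fin n) → H) (x : EuclideanSpace ℝ (Fin n)) : H :=
  ∑ i : Fin n, γ (EuclideanSpace.single i (1 : ℝ))
    (fderiv ℝ ψ x (EuclideanSpace.single i (1 : ℝ)))

/-- The spinor bubble `ψ⁻_Φ(x) = (2/(1+‖x‖²))^{n/2} (Φ − γ(x)Φ)`. -/
def psiNeg {n : ℕ} {H : Type*} [NormedAddCommGroup H] [InnerProductSpace ℝ H]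
    (γ : EuclideanSpace ℝ (Fin n) →ₗ[ℝ] H →ₗ[ℝ] H)
    (Φ : H) (x : EuclideanSpace ℝ (Fin n)) : H :=
  (((2 / (1 + ‖x‖ ^ 2) : ℝ)) ^ ((n : ℝ) / 2)) • (Φ - γ x Φ)

/-- The spinor bubble `ψ⁺_Φ(x) = (2/(1+‖x‖²))^{n/2} (Φ + γ(x)Φ)`. -/
def psiPos {n : ℕ} {H : Type*} [NormedAddCommGroup H] [InnerProductSpace ℝ H]
    (γ : EuclideanSpace ℝ (Fin n) →ₗ[ℝ] H →ₗ[ℝ] H)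
    (Φ : H) (x : EuclideanSpace ℝ (Fin n)) : H :=
  (((2 / (1 + ‖x‖ ^ 2) : ℝ)) ^ ((n : ℝ) / 2)) • (Φ + γ x Φ)

/-- The volume `ωₙ = 2 π^{(n+1)/2} / Γ((n+1)/2)` of the round unit `n`-sphere. -/
def sphereVol (n : ℕ) : ℝ :=
  2 * Real.pi ^ (((n : ℝ) + 1) / 2) / Real.Gamma (((n : ℝ) + 1) / 2)

/-- The conformal factor `2 / (1 + ‖x‖²)` of stereographic projection. -/
def conformalFactor {n : ℕ} (x : EuclideanSpace ℝ (Fin n)) : ℝ :=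
  2 / (1 + ‖x‖ ^ 2)

lemma conformalFactor_pos {n : ℕ} (x : EuclideanSpace ℝ (Fin n)) : 0 < conformalFactor x := by
  unfold conformalFactor
  positivity

lemma conformalFactor_mul {n : ℕ} (x : EuclideanSpace ℝ (Fin n)) :
    conformalFactor x * (1 + ‖x‖ ^ 2) = 2 := by
  have : (1 + ‖x‖ ^ 2) ≠ 0 := by positivity
  rw [conformalFactor, div_mul_cancel₀ _ this]

lemma hasDerivAt_two_div_one_add_rpow (p : ℝ) {s : ℝ} (hs : 0 ≤ s) :
    HasDerivAt (fun s : ℝ => (2 / (1 + s)) ^ p) (-(p * (2 / (1 + s)) ^ p / (1 + s))) s := by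
  have hpos : 0 < 1 + s := by positivity
  have hbase : HasDerivAt (fun s : ℝ => 2 / (1 + s)) (-(2 / (1 + s) ^ 2)) s := by
    have := (hasDerivAt_const s (2 : ℝ)).div ((hasDerivAt_id s).const_add 1) hpos.ne'
    convert! this using 1
    simp
    ring
  have h := hbase.rpow_const (p := p) (Or.inl (by positivity))
  convert! h using 1
  rw [Real.rpow_sub_one (by positivity)]
  field_simp

lemma hasFDerivAt_conformalFactor_rpow {n : ℕ} (p : ℝ) (x : EuclideanSpace ℝ (Fin n)) :
    HasFDerivAt (fun y : EuclideanSpace ℝ (Fin n) => conformalFactor y ^ p)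
      ((-(p * conformalFactor x ^ (p + 1))) • innerSL ℝ x) x := by
  have h := (hasDerivAt_two_div_one_add_rpow p (sq_nonneg ‖x‖)).comp_hasFDerivAt x
    (hasStrictFDerivAt_norm_sq x).hasFDerivAt
  convert! h using 1
  rw [Real.rpow_add_one (conformalFactor_pos x).ne', ← Nat.cast_smul_eq_nsmul ℝ, smul_smul]
  congr 1
  simp only [conformalFactor]
  push_cast
  ring

section Clifford

variable {n : ℕ} {H : Type*} [NormedAddCommGroup H] [InnerProductSpace ℝ H]
  {γ : EuclideanSpace ℝ (Fin n) →ₗ[ℝ] H →ₗ[ℝ] H}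

lemma clifford_mul_self
    (hcl : ∀ (v w : EuclideanSpace ℝ (Fin n)) (ψ : H),
      γ v (γ w ψ) + γ w (γ v ψ) = (-2 * ⟪v, w⟫) • ψ)
    (v : EuclideanSpace ℝ (Fin n)) (ψ : H) : γ v (γ v ψ) = (-‖v‖ ^ 2) • ψ := by
  have h := hcl v v ψ
  rw [real_inner_self_eq_norm_sq, ← two_smul ℝ, neg_mul, ← mul_neg, mul_smul] at h
  exact smul_right_injective H (two_ne_zero' ℝ) h

lemma norm_sub_clifford_sq
    (hcl : ∀ (v w : EuclideanSpace ℝ (Fin n)) (ψ : H),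
      γ v (γ w ψ) + γ w (γ v ψ) = (-2 * ⟪v, w⟫) • ψ)
    (hsk : ∀ (v : EuclideanSpace ℝ (Fin n)) (φ ψ : H), ⟪γ v φ, ψ⟫ = - ⟪φ, γ v ψ⟫)
    (v : EuclideanSpace ℝ (Fin n)) (ψ : H) :
    ‖ψ - γ v ψ‖ ^ 2 = (1 + ‖v‖ ^ 2) * ‖ψ‖ ^ 2 := by
  have hcross : ⟪ψ, γ v ψ⟫ = 0 := by
    have h := hsk v ψ ψ
    rw [real_inner_comm] at h
    linarith
  have hnorm : ‖γ v ψ‖ ^ 2 = ‖v‖ ^ 2 * ‖ψ‖ ^ 2 := by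
    rw [← real_inner_self_eq_norm_sq, hsk, clifford_mul_self hcl, real_inner_smul_right,
      real_inner_self_eq_norm_sq]
    ring
  rw [norm_sub_sq_real, hcross, hnorm]
  ring

lemma sum_inner_smul_clifford_single (x : EuclideanSpace ℝ (Fin n)) (ψ : H) :
    ∑ i : Fin n, ⟪x, EuclideanSpace.single i (1 : ℝ)⟫ • γ (EuclideanSpace.single i (1 : ℝ)) ψ
      = γ x ψ := by
  have h := (EuclideanSpace.basisFun (Fin n) ℝ).sum_repr' x
  simp only [EuclideanSpace.basisFun_apply] at h
  conv_rhs => rw [← h]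
  simp [LinearMap.sum_apply, real_inner_comm]

lemma fderiv_psiNeg (Φ : H) (x v : EuclideanSpace ℝ (Fin n)) :
    fderiv ℝ (psiNeg γ Φ) x v
      = -(conformalFactor x ^ ((n : ℝ) / 2) • γ v Φ)
        - ((n : ℝ) / 2 * conformalFactor x ^ ((n : ℝ) / 2 + 1) * ⟪x, v⟫) • (Φ - γ x Φ) := by
  have hlin : HasFDerivAt (fun y => Φ - γ y Φ)
      (-(LinearMap.toContinuousLinearMap (γ.flip Φ))) x :=
    (LinearMap.toContinuousLinearMap (γ.flip Φ)).hasFDerivAt.const_sub Φ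
  have h : HasFDerivAt (psiNeg γ Φ) _ x :=
    (hasFDerivAt_conformalFactor_rpow ((n : ℝ) / 2) x).smul hlin
  rw [h.fderiv]
  simp
  module

lemma dirac_psiNeg
    (hcl : ∀ (v w : EuclideanSpace ℝ (Fin n)) (ψ : H),
      γ v (γ w ψ) + γ w (γ v ψ) = (-2 * ⟪v, w⟫) • ψ)
    (Φ : H) (x : EuclideanSpace ℝ (Fin n)) :
    Dirac γ (psiNeg γ Φ) x = ((n : ℝ) / 2 * conformalFactor x) • psiNeg γ Φ x := by
  have hterm (i : Fin n) : γ (EuclideanSpace.single i (1 : ℝ))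
      (fderiv ℝ (psiNeg γ Φ) x (EuclideanSpace.single i (1 : ℝ)))
      = conformalFactor x ^ ((n : ℝ) / 2) • Φ
        - ((n : ℝ) / 2 * conformalFactor x ^ ((n : ℝ) / 2 + 1)) •
          (⟪x, EuclideanSpace.single i (1 : ℝ)⟫ •
            γ (EuclideanSpace.single i (1 : ℝ)) (Φ - γ x Φ)) := by
    rw [fderiv_psiNeg, map_sub, map_neg, map_smul, map_smul, clifford_mul_self hcl]
    simp only [PiLp.norm_single, norm_one]
    module
  simp only [Dirac, hterm]
  rw [Finset.sum_sub_distrib, ← Finset.smul_sum, ← Finset.smul_sum,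
    sum_inner_smul_clifford_single, map_sub, clifford_mul_self hcl,
    Real.rpow_add_one (conformalFactor_pos x).ne']
  have hψ : psiNeg γ Φ x = conformalFactor x ^ ((n : ℝ) / 2) • (Φ - γ x Φ) := rfl
  rw [hψ, Finset.sum_const, Finset.card_univ, Fintype.card_fin, ← Nat.cast_smul_eq_nsmul ℝ]
  have hf := conformalFactor_mul x
  set c := conformalFactor x ^ ((n : ℝ) / 2)
  match_scalars
  · linear_combination (-(n : ℝ) / 2 * c) * hf
  · ring

lemma norm_psiNeg_sq
    (hcl : ∀ (v w : EuclideanSpace ℝ (Fin n)) (ψ : H),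
      γ v (γ w ψ) + γ w (γ v ψ) = (-2 * ⟪v, w⟫) • ψ)
    (hsk : ∀ (v : EuclideanSpace ℝ (Fin n)) (φ ψ : H), ⟪γ v φ, ψ⟫ = - ⟪φ, γ v ψ⟫)
    (Φ : H) (x : EuclideanSpace ℝ (Fin n)) :
    conformalFactor x * ‖psiNeg γ Φ x‖ ^ 2 = 2 * ‖Φ‖ ^ 2 * conformalFactor x ^ n := by
  have hf := conformalFactor_pos x
  have hψ : psiNeg γ Φ x = conformalFactor x ^ ((n : ℝ) / 2) • (Φ - γ x Φ) := rfl
  have hpow : (conformalFactor x ^ ((n : ℝ) / 2)) ^ 2 = conformalFactor x ^ n := by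
    rw [← Real.rpow_mul_natCast hf.le, Nat.cast_ofNat, div_mul_cancel₀ _ (two_ne_zero' ℝ),
      Real.rpow_natCast]
  rw [hψ, norm_smul, mul_pow, Real.norm_eq_abs, sq_abs, hpow, norm_sub_clifford_sq hcl hsk]
  linear_combination (conformalFactor x ^ n * ‖Φ‖ ^ 2) * conformalFactor_mul x

lemma inner_dirac_psiNeg
    (hcl : ∀ (v w : EuclideanSpace ℝ (Fin n)) (ψ : H),
      γ v (γ w ψ) + γ w (γ v ψ) = (-2 * ⟪v, w⟫) • ψ)
    (hsk : ∀ (v : EuclideanSpace ℝ (Fin n)) (φ ψ : H), ⟪γ v φ, ψ⟫ = - ⟪φ, γ v ψ⟫)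
    (Φ : H) (x : EuclideanSpace ℝ (Fin n)) :
    ⟪Dirac γ (psiNeg γ Φ) x, psiNeg γ Φ x⟫ = n * ‖Φ‖ ^ 2 * conformalFactor x ^ n := by
  rw [dirac_psiNeg hcl, real_inner_smul_left, real_inner_self_eq_norm_sq]
  linear_combination ((n : ℝ) / 2) * norm_psiNeg_sq hcl hsk Φ x

lemma norm_dirac_psiNeg_rpow
    (hcl : ∀ (v w : EuclideanSpace ℝ (Fin n)) (ψ : H),
      γ v (γ w ψ) + γ w (γ v ψ) = (-2 * ⟪v, w⟫) • ψ)
    (hsk : ∀ (v : EuclideanSpace ℝ (Fin n)) (φ ψ : H), ⟪γ v φ, ψ⟫ = - ⟪φ, γ v ψ⟫)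
    (Φ : H) (x : EuclideanSpace ℝ (Fin n)) :
    ‖Dirac γ (psiNeg γ Φ) x‖ ^ (2 * (n : ℝ) / ((n : ℝ) + 1))
      = ((n : ℝ) ^ 2 / 2 * ‖Φ‖ ^ 2) ^ ((n : ℝ) / ((n : ℝ) + 1)) * conformalFactor x ^ n := by
  have hf := conformalFactor_pos x
  have hsq : ‖Dirac γ (psiNeg γ Φ) x‖ ^ 2
      = (n : ℝ) ^ 2 / 2 * ‖Φ‖ ^ 2 * conformalFactor x ^ ((n : ℝ) + 1) := by
    rw [dirac_psiNeg hcl, norm_smul, mul_pow, Real.norm_eq_abs, sq_abs,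
      Real.rpow_add_one hf.ne', Real.rpow_natCast]
    linear_combination ((n : ℝ) ^ 2 / 4 * conformalFactor x) * norm_psiNeg_sq hcl hsk Φ x
  have hn1 : (n : ℝ) + 1 ≠ 0 := by positivity
  rw [mul_div_assoc, Real.rpow_mul (norm_nonneg _), Real.rpow_two, hsq,
    Real.mul_rpow (by positivity) (by positivity), ← Real.rpow_mul hf.le,
    mul_div_cancel₀ _ hn1, Real.rpow_natCast]

end Clifford

lemma integrable_inv_one_add_norm_sq_pow {n : ℕ} (hn : 0 < n) :
    Integrable (fun x : EuclideanSpace ℝ (Fin n) => ((1 + ‖x‖ ^ 2)⁻¹) ^ n) := by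
  have hn' : (0 : ℝ) < n := by exact_mod_cast hn
  have h := integrable_rpow_neg_one_add_norm_sq (E := EuclideanSpace ℝ (Fin n))
    (μ := volume) (r := 2 * (n : ℝ)) (by simp; linarith)
  refine h.congr (.of_forall fun x => ?_)
  have : (0 : ℝ) ≤ 1 + ‖x‖ ^ 2 := by positivity
  simp only
  rw [show -(2 * (n : ℝ)) / 2 = -n by ring, Real.rpow_neg this, Real.rpow_natCast, inv_pow]

lemma integral_inv_one_add_norm_sq_pow {n : ℕ} (hn : 0 < n) :
    ∫ x : EuclideanSpace ℝ (Fin n), ((1 + ‖x‖ ^ 2)⁻¹) ^ n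
      = Real.pi ^ ((n : ℝ) / 2) * Real.Gamma ((n : ℝ) / 2) / Real.Gamma n := by
  have hn' : (0 : ℝ) < n := by exact_mod_cast hn
  have hΓ : Real.Gamma n ≠ 0 := (Real.Gamma_pos_of_pos hn').ne'
  have hinner (x : EuclideanSpace ℝ (Fin n)) :
      ∫ t in Set.Ioi (0 : ℝ), t ^ ((n : ℝ) - 1) * Real.exp (-((1 + ‖x‖ ^ 2) * t))
        = ((1 + ‖x‖ ^ 2)⁻¹) ^ n * Real.Gamma n := by
    rw [Real.integral_rpow_mul_exp_neg_mul_Ioi hn' (by positivity), one_div, Real.rpow_natCast]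
  have hint : Integrable (Function.uncurry fun (x : EuclideanSpace ℝ (Fin n)) (t : ℝ) =>
      t ^ ((n : ℝ) - 1) * Real.exp (-((1 + ‖x‖ ^ 2) * t)))
      (volume.prod (volume.restrict (Set.Ioi 0))) := by
    have hmeas : Measurable (Function.uncurry fun (x : EuclideanSpace ℝ (Fin n)) (t : ℝ) =>
        t ^ ((n : ℝ) - 1) * Real.exp (-((1 + ‖x‖ ^ 2) * t))) := by
      unfold Function.uncurry
      fun_prop
    refine (integrable_prod_iff hmeas.aestronglyMeasurable).2 ⟨.of_forall fun x => ?_, ?_⟩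
    · have h := integrableOn_rpow_mul_exp_neg_mul_rpow (s := (n : ℝ) - 1) (p := 1)
        (b := 1 + ‖x‖ ^ 2) (by linarith) one_pos (by positivity)
      simpa only [IntegrableOn, Function.uncurry, Real.rpow_one, neg_mul] using h
    · refine ((integrable_inv_one_add_norm_sq_pow hn).mul_const (Real.Gamma n)).congr
        (.of_forall fun x => ?_)
      simp only [Function.uncurry_apply_pair]
      rw [← hinner x]
      refine setIntegral_congr_fun measurableSet_Ioi fun t ht => ?_
      have ht' : (0 : ℝ) < t := ht
      exact (Real.norm_of_nonneg (by positivity)).symm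
  have hswap := integral_integral_swap hint
  simp only [hinner] at hswap
  rw [integral_mul_const] at hswap
  rw [eq_div_iff hΓ, hswap]
  have hgauss : ∀ t ∈ Set.Ioi (0 : ℝ),
      ∫ x : EuclideanSpace ℝ (Fin n), t ^ ((n : ℝ) - 1) * Real.exp (-((1 + ‖x‖ ^ 2) * t))
        = Real.pi ^ ((n : ℝ) / 2) * (t ^ ((n : ℝ) / 2 - 1) * Real.exp (-(1 * t))) := by
    intro t ht
    have ht' : (0 : ℝ) < t := ht
    have hsplit (x : EuclideanSpace ℝ (Fin n)) :
        t ^ ((n : ℝ) - 1) * Real.exp (-((1 + ‖x‖ ^ 2) * t))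
          = t ^ ((n : ℝ) - 1) * Real.exp (-(1 * t)) * Real.exp (-t * ‖x‖ ^ 2) := by
      rw [mul_assoc, ← Real.exp_add]
      ring_nf
    simp only [hsplit]
    rw [integral_const_mul, GaussianFourier.integral_rexp_neg_mul_sq_norm ht',
      finrank_euclideanSpace_fin, Real.div_rpow Real.pi_pos.le ht'.le,
      show (n : ℝ) - 1 = ((n : ℝ) / 2 - 1) + (n : ℝ) / 2 by ring, Real.rpow_add ht']
    have : t ^ ((n : ℝ) / 2) ≠ 0 := by positivity
    field_simp
  rw [setIntegral_congr_fun measurableSet_Ioi hgauss, integral_const_mul,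
    Real.integral_rpow_mul_exp_neg_mul_Ioi (by positivity) one_pos]
  simp

lemma integrable_conformalFactor_pow {n : ℕ} (hn : 0 < n) :
    Integrable (fun x : EuclideanSpace ℝ (Fin n) => conformalFactor x ^ n) := by
  simpa only [conformalFactor, div_eq_mul_inv, mul_pow] using
    (integrable_inv_one_add_norm_sq_pow hn).const_mul (2 ^ n)

lemma integral_conformalFactor_pow {n : ℕ} (hn : 0 < n) :
    ∫ x : EuclideanSpace ℝ (Fin n), conformalFactor x ^ n = sphereVol n := by
  have hn' : (0 : ℝ) < n := by exact_mod_cast hn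
  simp only [conformalFactor, div_eq_mul_inv, mul_pow]
  rw [integral_const_mul, integral_inv_one_add_norm_sq_pow hn, sphereVol]
  have hdup := Real.Gamma_mul_Gamma_add_half ((n : ℝ) / 2)
  rw [mul_div_cancel₀ _ (two_ne_zero' ℝ), ← add_div, Real.rpow_sub two_pos, Real.rpow_one,
    Real.rpow_natCast, Real.sqrt_eq_rpow] at hdup
  have h1 : Real.Gamma (((n : ℝ) + 1) / 2) ≠ 0 := (Real.Gamma_pos_of_pos (by positivity)).ne'
  have h2 : Real.Gamma n ≠ 0 := (Real.Gamma_pos_of_pos hn').ne'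
  rw [← mul_div_assoc, div_eq_div_iff h2 h1, add_div, Real.rpow_add Real.pi_pos]
  rw [add_div] at hdup
  have h3 : (2 : ℝ) ^ n * (2 / 2 ^ n) = 2 := by field_simp
  linear_combination (2 ^ n * Real.pi ^ ((n : ℝ) / 2)) * hdup
    + (Real.pi ^ ((n : ℝ) / 2) * Real.Gamma n * Real.pi ^ ((1 : ℝ) / 2)) * h3

lemma sphereVol_pos (n : ℕ) : 0 < sphereVol n := by
  have := Real.Gamma_pos_of_pos (show 0 < ((n : ℝ) + 1) / 2 by positivity)
  unfold sphereVol
  positivity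

/-- For `n ≥ 2` and `0 ≠ Φ ∈ H`, the spinor bubble `ψ⁻_Φ` achieves
equality in the sharp spinorial Sobolev inequality on `ℝⁿ`:
`(∫ ‖Dψ⁻_Φ‖^{2n/(n+1)})^{(n+1)/n} = (n/2) ωₙ^{1/n} ∫ ⟨Dψ⁻_Φ, ψ⁻_Φ⟩`,
where both integrals are finite. -/
theorem psiNeg_equality_spinorial_sobolev {n : ℕ} {H : Type*} [NormedAddCommGroup H]
    [InnerProductSpace ℝ H] [FiniteDimensional ℝ H]
    (hn : 2 ≤ n)
    (γ : EuclideanSpace ℝ (Fin n) →ₗ[ℝ] H →ₗ[ℝ] H)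
    (hcl : ∀ (v w : EuclideanSpace ℝ (Fin n)) (ψ : H),
      γ v (γ w ψ) + γ w (γ v ψ) = (-2 * ⟪v, w⟫) • ψ)
    (hsk : ∀ (v : EuclideanSpace ℝ (Fin n)) (φ ψ : H),
      ⟪γ v φ, ψ⟫ = - ⟪φ, γ v ψ⟫)
    (Φ : H) (hΦ : Φ ≠ 0) :
    Integrable (fun x : EuclideanSpace ℝ (Fin n) =>
      ‖Dirac γ (psiNeg γ Φ) x‖ ^ (2 * (n : ℝ) / ((n : ℝ) + 1))) ∧
    Integrable (fun x : EuclideanSpace ℝ (Fin n) =>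
      ⟪Dirac γ (psiNeg γ Φ) x, psiNeg γ Φ x⟫) ∧
    (∫ x : EuclideanSpace ℝ (Fin n),
        ‖Dirac γ (psiNeg γ Φ) x‖ ^ (2 * (n : ℝ) / ((n : ℝ) + 1)))
        ^ (((n : ℝ) + 1) / (n : ℝ)) =
      (n : ℝ) / 2 * sphereVol n ^ ((1 : ℝ) / (n : ℝ)) *
        ∫ x : EuclideanSpace ℝ (Fin n), ⟪Dirac γ (psiNeg γ Φ) x, psiNeg γ Φ x⟫ := by
  have hn0 : 0 < n := by omega
  have hn' : (n : ℝ) ≠ 0 := by positivity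
  have hn1 : (n : ℝ) + 1 ≠ 0 := by positivity
  have hω := sphereVol_pos n
  simp only [norm_dirac_psiNeg_rpow hcl hsk, inner_dirac_psiNeg hcl hsk]
  refine ⟨(integrable_conformalFactor_pow hn0).const_mul _,
    (integrable_conformalFactor_pow hn0).const_mul _, ?_⟩
  rw [integral_const_mul, integral_const_mul, integral_conformalFactor_pow hn0,
    Real.mul_rpow (by positivity) hω.le, ← Real.rpow_mul (by positivity),
    div_mul_div_cancel₀ hn1, div_self hn', Real.rpow_one, add_div, div_self hn',
    Real.rpow_add hω, Real.rpow_one]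
  ring
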